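/- arXiv:2402.06006 — 6 statements merged into one kernel-verified Lean document; each statement's English description precedes it below -/
import Mathlib

section
/- (i) The map γ ↦ (z₁(γ), z₂(γ)) from SL₂(ℤ) to ℤ[i] × ℤ[i] is injective. (ii) If ν(γ) = n then N(z₁(γ)) = n + 2 and N(z₂(γ)) = n − 2. (iii) With γ_i = !![0, 1; −1, 0], for all integers j₁, j₂ one has z₁(γ_i^{j₁} γ γ_i^{j₂}) = i^{j₁+j₂}·z₁(γ) and z₂(γ_i^{j₁} γ γ_i^{j₂}) = i^{j₁−j₂}·z₂(γ). (iv) For γ = !![a, b; c, d] ∈ SL₂(ℤ) with c·i + d ≠ 0, writing γ·i = (a·i + b)/(c·i + d) ∈ ℂ, one has (γ·i − i)/(γ·i + i) = z₂(γ)/conj(z₁(γ)). -/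
open Matrix Complex

noncomputable section

/-- `SL₂(ℤ)`, the group of 2×2 integer matrices of determinant 1. -/
abbrev SL2Z := Matrix.SpecialLinearGroup (Fin 2) ℤ

/-- `ν(γ) = a² + b² + c² + d²`. -/
def nuH (γ : SL2Z) : ℤ := (γ.1 0 0) ^ 2 + (γ.1 0 1) ^ 2 + (γ.1 1 0) ^ 2 + (γ.1 1 1) ^ 2

/-- `z₁(γ) = (a + d) + (b - c)i ∈ ℤ[i]`. -/
def z1 (γ : SL2Z) : GaussianInt := ⟨γ.1 0 0 + γ.1 1 1, γ.1 0 1 - γ.1 1 0⟩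

/-- `z₂(γ) = (a - d) - (b + c)i ∈ ℤ[i]`. -/
def z2 (γ : SL2Z) : GaussianInt := ⟨γ.1 0 0 - γ.1 1 1, -(γ.1 0 1 + γ.1 1 0)⟩

/-- The elliptic element `γ_i = !![0, 1; -1, 0] ∈ SL₂(ℤ)`. -/
def gammaI : SL2Z := ⟨!![0, 1; -1, 0], by norm_num [Matrix.det_fin_two_of]⟩

/-- The imaginary unit `i` as a unit of `ℤ[i]`. -/
def iUnit : (GaussianInt)ˣ := ⟨⟨0, 1⟩, ⟨0, -1⟩, by decide, by decide⟩

theorem apply_zpow_mul {G M : Type*} [Group G] [Monoid M] {f : G → M} {g : G} {u : Mˣ}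
    (hf : ∀ x, f (g * x) = u * f x) (j : ℤ) (x : G) :
    f (g ^ j * x) = ((u ^ j : Mˣ) : M) * f x := by
  induction j generalizing x with
  | zero => simp
  | succ n ih => rw [_root_.zpow_add_one, mul_assoc, ih, hf, _root_.zpow_add_one, Units.val_mul, mul_assoc]
  | pred n ih =>
    have h : f (g⁻¹ * x) = ((u⁻¹ : Mˣ) : M) * f x := by
      rw [Units.eq_inv_mul_iff_mul_eq, ← hf, mul_inv_cancel_left]
    rw [_root_.zpow_sub_one, mul_assoc, ih, h, _root_.zpow_sub_one, Units.val_mul, mul_assoc]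

theorem apply_mul_zpow {G M : Type*} [Group G] [Monoid M] {f : G → M} {g : G} {u : Mˣ}
    (hf : ∀ x, f (x * g) = u * f x) (j : ℤ) (x : G) :
    f (x * g ^ j) = ((u ^ j : Mˣ) : M) * f x := by
  induction j generalizing x with
  | zero => simp
  | succ n ih =>
    rw [add_comm, _root_.zpow_one_add, ← mul_assoc, ih, hf, add_comm, _root_.zpow_add_one, Units.val_mul,
      mul_assoc]
  | pred n ih =>
    have h : f (x * g⁻¹) = ((u⁻¹ : Mˣ) : M) * f x := by
      rw [Units.eq_inv_mul_iff_mul_eq, ← hf, inv_mul_cancel_right]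
    have hg : g ^ (-(n : ℤ) - 1) = g⁻¹ * g ^ (-(n : ℤ)) := by
      rw [sub_eq_neg_add, _root_.zpow_add, _root_.zpow_neg_one]
    rw [hg, ← mul_assoc, ih, h, _root_.zpow_sub_one, Units.val_mul, mul_assoc]

theorem val_gammaI_mul (γ : SL2Z) :
    gammaI.1 * γ.1 = !![γ.1 1 0, γ.1 1 1; -γ.1 0 0, -γ.1 0 1] := by
  change !![0, 1; -1, 0] * γ.1 = _
  ext i j
  fin_cases i <;> fin_cases j <;> simp [Matrix.mul_apply]

theorem val_mul_gammaI (γ : SL2Z) :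
    γ.1 * gammaI.1 = !![-γ.1 0 1, γ.1 0 0; -γ.1 1 1, γ.1 1 0] := by
  change γ.1 * !![0, 1; -1, 0] = _
  ext i j
  fin_cases i <;> fin_cases j <;> simp [Matrix.mul_apply]

theorem z1_gammaI_mul (γ : SL2Z) : z1 (gammaI * γ) = iUnit * z1 γ := by
  ext <;> simp [z1, val_gammaI_mul, iUnit] <;> ring

theorem z1_mul_gammaI (γ : SL2Z) : z1 (γ * gammaI) = iUnit * z1 γ := by
  ext <;> simp [z1, val_mul_gammaI, iUnit]
  ring

theorem z2_gammaI_mul (γ : SL2Z) : z2 (gammaI * γ) = iUnit * z2 γ := by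
  ext <;> simp [z2, val_gammaI_mul, iUnit] <;> ring

theorem z2_mul_gammaI (γ : SL2Z) : z2 (γ * gammaI) = (iUnit⁻¹ : GaussianIntˣ) * z2 γ := by
  ext <;> simp [z2, val_mul_gammaI, iUnit] <;> ring

theorem stmt0 :
    -- (i) injectivity
    (Function.Injective (fun γ : SL2Z => (z1 γ, z2 γ))) ∧
    -- (ii) norms
    (∀ (γ : SL2Z) (n : ℤ), nuH γ = n → (z1 γ).norm = n + 2 ∧ (z2 γ).norm = n - 2) ∧
    -- (iii) behaviour under γ_i^{j₁} γ γ_i^{j₂}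
    (∀ (γ : SL2Z) (j₁ j₂ : ℤ),
      z1 (gammaI ^ j₁ * γ * gammaI ^ j₂) =
        ((iUnit ^ (j₁ + j₂) : (GaussianInt)ˣ) : GaussianInt) * z1 γ ∧
      z2 (gammaI ^ j₁ * γ * gammaI ^ j₂) =
        ((iUnit ^ (j₁ - j₂) : (GaussianInt)ˣ) : GaussianInt) * z2 γ) ∧
    -- (iv) disc model formula
    (∀ γ : SL2Z, ((γ.1 1 0 : ℂ) * Complex.I + (γ.1 1 1 : ℂ)) ≠ 0 →
      (((γ.1 0 0 : ℂ) * Complex.I + (γ.1 0 1 : ℂ)) /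
            ((γ.1 1 0 : ℂ) * Complex.I + (γ.1 1 1 : ℂ)) - Complex.I) /
          (((γ.1 0 0 : ℂ) * Complex.I + (γ.1 0 1 : ℂ)) /
            ((γ.1 1 0 : ℂ) * Complex.I + (γ.1 1 1 : ℂ)) + Complex.I) =
        GaussianInt.toComplex (z2 γ) / (starRingEnd ℂ) (GaussianInt.toComplex (z1 γ))) := by
  refine ⟨fun γ δ h => ?_, fun γ n h => ?_, fun γ j₁ j₂ => ⟨?_, ?_⟩, fun γ h => ?_⟩
  · simp only [z1, z2, Prod.mk.injEq, Zsqrtd.mk.injEq] at h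
    ext i j
    fin_cases i <;> fin_cases j <;> simp <;> omega
  · have hdet := γ.det_coe
    rw [Matrix.det_fin_two] at hdet
    simp only [nuH] at h
    simp only [z1, z2, Zsqrtd.norm_def]
    constructor <;> linarith
  · rw [apply_mul_zpow z1_mul_gammaI, apply_zpow_mul z1_gammaI_mul, ← mul_assoc,
      ← Units.val_mul, ← _root_.zpow_add, add_comm]
  · rw [apply_mul_zpow z2_mul_gammaI, apply_zpow_mul z2_gammaI_mul, ← mul_assoc,
      ← Units.val_mul, _root_.inv_zpow', ← _root_.zpow_add, neg_add_eq_sub]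
  · have hnum : ((γ.1 0 0 : ℂ) * Complex.I + γ.1 0 1) -
        Complex.I * ((γ.1 1 0 : ℂ) * Complex.I + γ.1 1 1) =
        Complex.I * GaussianInt.toComplex (z2 γ) := by
      apply Complex.ext <;> simp [z2]
    have hden : ((γ.1 0 0 : ℂ) * Complex.I + γ.1 0 1) +
        Complex.I * ((γ.1 1 0 : ℂ) * Complex.I + γ.1 1 1) =
        Complex.I * (starRingEnd ℂ) (GaussianInt.toComplex (z1 γ)) := by
      apply Complex.ext <;> simp [z1, sub_eq_add_neg]
    rw [div_sub' h, div_add' _ _ _ h, div_div_div_cancel_right₀ h,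
      mul_comm ((γ.1 1 0 : ℂ) * Complex.I + γ.1 1 1), hnum, hden,
      mul_div_mul_left _ _ Complex.I_ne_zero]

end
end

section
/- For every integer n ≥ 2 with n ≡ 2 (mod 4), the map γ ↦ (z₁(γ), z₂(γ)) is a bijection from {γ ∈ SL₂(ℤ) : ν(γ) = n} onto B_n = {z₁ ∈ ℤ[i] : N(z₁) = n+2} × {z₂ ∈ ℤ[i] : N(z₂) = n−2}. -/
open Matrix Complex

noncomputable section

/-- Two integers whose squares sum to a multiple of four are both even. -/
theorem even_and_even_of_four_dvd_sq_add_sq {x y : ℤ} (hxy : 4 ∣ x ^ 2 + y ^ 2) :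
    Even x ∧ Even y := by
  rcases Int.even_or_odd' x with ⟨p, rfl | rfl⟩ <;> rcases Int.even_or_odd' y with ⟨q, rfl | rfl⟩
  · simp
  all_goals ring_nf at hxy; omega

/-- For n ≥ 2 with n ≡ 2 (mod 4), γ ↦ (z₁(γ), z₂(γ)) is a bijection from
{γ : ν(γ) = n} onto B_n = {N(z₁) = n+2} × {N(z₂) = n−2}. -/
theorem stmt2 (n : ℤ) (h2 : 2 ≤ n) (h : n % 4 = 2) :
    Set.BijOn (fun γ : SL2Z => (z1 γ, z2 γ)) {γ : SL2Z | nuH γ = n}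
      {p : GaussianInt × GaussianInt | p.1.norm = n + 2 ∧ p.2.norm = n - 2} := by
  refine ⟨fun γ hγ => ?_, fun γ _ δ _ hγδ => ?_, ?_⟩
  · have hdet := γ.det_coe
    rw [Matrix.det_fin_two] at hdet
    simp only [Set.mem_ofPred_eq, nuH] at hγ
    simp only [Set.mem_ofPred_eq, z1, z2, Zsqrtd.norm_def]
    constructor <;> linarith
  · simp only [Prod.mk.injEq, z1, z2, Zsqrtd.ext_iff] at hγδ
    ext i j
    fin_cases i <;> fin_cases j <;> simp <;> omega
  · rintro ⟨⟨x, y⟩, ⟨u, v⟩⟩ ⟨h₁, h₂⟩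
    simp only [Zsqrtd.norm_def] at h₁ h₂
    obtain ⟨⟨p, rfl⟩, ⟨q, rfl⟩⟩ : Even x ∧ Even y :=
      even_and_even_of_four_dvd_sq_add_sq (by ring_nf at h₁ ⊢; omega)
    obtain ⟨⟨r, rfl⟩, ⟨s, rfl⟩⟩ : Even u ∧ Even v :=
      even_and_even_of_four_dvd_sq_add_sq (by ring_nf at h₂ ⊢; omega)
    refine ⟨⟨!![p + r, q - s; -q - s, p - r], ?_⟩, ?_, ?_⟩
    · rw [Matrix.det_fin_two_of]
      linarith
    · change (p + r) ^ 2 + (q - s) ^ 2 + (-q - s) ^ 2 + (p - r) ^ 2 = n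
      linarith
    · ext <;> simp [z1, z2]

end
end

section
/- Let g = !![a, b; c, d] ∈ SL₂(ℝ) with a·b·c·d ≠ 0. Then there exist unique y₁, y₂ > 0 such that the matrix g' = A(y₁)⁻¹ · g · A(y₂)⁻¹ = !![α, β; γ, δ] satisfies |α| = |δ| and |β| = |γ|; moreover y₁ = |ab/(cd)|^{1/2} and y₂ = |ac/(bd)|^{1/2}. -/
open Matrix

noncomputable section

/-- `A(y) = !![√y, 0; 0, 1/√y]`. -/
def Amat (y : ℝ) : Matrix (Fin 2) (Fin 2) ℝ := !![Real.sqrt y, 0; 0, 1 / Real.sqrt y]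

/-- The condition that `A(y₁)⁻¹ * g * A(y₂)⁻¹` has `|α| = |δ|` and `|β| = |γ|`,
for `p = (y₁, y₂)` with `y₁, y₂ > 0`. -/
def balanced (g : Matrix (Fin 2) (Fin 2) ℝ) (p : ℝ × ℝ) : Prop :=
  0 < p.1 ∧ 0 < p.2 ∧
    |((Amat p.1)⁻¹ * g * (Amat p.2)⁻¹) 0 0| = |((Amat p.1)⁻¹ * g * (Amat p.2)⁻¹) 1 1| ∧
    |((Amat p.1)⁻¹ * g * (Amat p.2)⁻¹) 0 1| = |((Amat p.1)⁻¹ * g * (Amat p.2)⁻¹) 1 0|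

theorem Amat_inv {y : ℝ} (hy : 0 < y) :
    (Amat y)⁻¹ = !![1 / Real.sqrt y, 0; 0, Real.sqrt y] := by
  have hs := (Real.sqrt_pos.mpr hy).ne'
  refine Matrix.inv_eq_right_inv ?_
  simp [Amat, Matrix.one_fin_two, hs]

/-- Balancedness in terms of the entries of `g`: `|a| = |d| y₁ y₂` and `|b| y₂ = |c| y₁`. -/
theorem balanced_iff (g : Matrix (Fin 2) (Fin 2) ℝ) (p : ℝ × ℝ) :
    balanced g p ↔ 0 < p.1 ∧ 0 < p.2 ∧
      |g 0 0| = |g 1 1| * (p.1 * p.2) ∧ |g 0 1| * p.2 = |g 1 0| * p.1 := by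
  unfold balanced
  refine and_congr_right fun h₁ => and_congr_right fun h₂ => ?_
  have hs := Real.sqrt_pos.mpr h₁
  have ht := Real.sqrt_pos.mpr h₂
  have hs2 := Real.sq_sqrt h₁.le
  have ht2 := Real.sq_sqrt h₂.le
  rw [Amat_inv h₁, Amat_inv h₂]
  simp only [Matrix.mul_apply, Fin.sum_univ_two, Matrix.of_apply, Matrix.cons_val',
    Matrix.cons_val_zero,
    Matrix.cons_val_one, Matrix.cons_val_fin_one, mul_zero, zero_mul, add_zero, zero_add, abs_mul,
    abs_div, abs_one, abs_of_pos hs, abs_of_pos ht]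
  refine and_congr ?_ ?_
  · rw [← hs2, ← ht2, Real.sqrt_sq hs.le, Real.sqrt_sq ht.le]
    field_simp
  · nth_rewrite 3 [← ht2]
    nth_rewrite 3 [← hs2]
    field_simp

theorem balanced_iff_eq_sqrt (g : Matrix (Fin 2) (Fin 2) ℝ)
    (h : g 0 0 * g 0 1 * g 1 0 * g 1 1 ≠ 0) (p : ℝ × ℝ) :
    balanced g p ↔ p = (Real.sqrt |g 0 0 * g 0 1 / (g 1 0 * g 1 1)|,
      Real.sqrt |g 0 0 * g 1 0 / (g 0 1 * g 1 1)|) := by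
  obtain ⟨y₁, y₂⟩ := p
  simp only [ne_eq, mul_eq_zero, not_or] at h
  obtain ⟨⟨⟨ha, hb⟩, hc⟩, hd⟩ := h
  rw [balanced_iff, Prod.mk.injEq]
  simp only [abs_div, abs_mul]
  have ha := abs_pos.mpr ha
  have hb := abs_pos.mpr hb
  have hc := abs_pos.mpr hc
  have hd := abs_pos.mpr hd
  generalize |g 0 0| = a at *
  generalize |g 0 1| = b at *
  generalize |g 1 0| = c at *
  generalize |g 1 1| = d at *
  constructor
  · rintro ⟨h₁, h₂, h₃, h₄⟩
    refine ⟨(Real.sqrt_eq_iff_eq_sq (by positivity) h₁.le |>.mpr (Eq.symm ?_)).symm,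
      (Real.sqrt_eq_iff_eq_sq (by positivity) h₂.le |>.mpr (Eq.symm ?_)).symm⟩
    · rw [eq_div_iff (by positivity), h₃]
      linear_combination (-d * y₁) * h₄
    · rw [eq_div_iff (by positivity), h₃]
      linear_combination (d * y₂) * h₄
  · rintro ⟨rfl, rfl⟩
    refine ⟨by positivity, by positivity, ?_, ?_⟩
    · rw [← Real.sqrt_mul (by positivity),
        show a * b / (c * d) * (a * c / (b * d)) = (a / d) ^ 2 by field_simp,
        Real.sqrt_sq (by positivity)]
      field_simp
    · rw [show a * b / (c * d) = (b / c) ^ 2 * (a * c / (b * d)) by field_simp,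
        Real.sqrt_mul (by positivity), Real.sqrt_sq (by positivity)]
      field_simp

/-- Existence and uniqueness of `y₁, y₂ > 0` with `A(y₁)⁻¹ g A(y₂)⁻¹` balanced,
together with the explicit formulas `y₁ = |ab/(cd)|^{1/2}`, `y₂ = |ac/(bd)|^{1/2}`. -/
theorem stmt9 (g : Matrix (Fin 2) (Fin 2) ℝ) (hdet : g.det = 1)
    (h : g 0 0 * g 0 1 * g 1 0 * g 1 1 ≠ 0) :
    balanced g (Real.sqrt |g 0 0 * g 0 1 / (g 1 0 * g 1 1)|,
      Real.sqrt |g 0 0 * g 1 0 / (g 0 1 * g 1 1)|) ∧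
    ∀ p : ℝ × ℝ, balanced g p →
      p = (Real.sqrt |g 0 0 * g 0 1 / (g 1 0 * g 1 1)|,
        Real.sqrt |g 0 0 * g 1 0 / (g 0 1 * g 1 1)|) := by
  exact ⟨(balanced_iff_eq_sqrt g h _).mpr rfl, fun p => (balanced_iff_eq_sqrt g h p).mp⟩

end
end

section
/- Let g = !![a, b; c, d] ∈ SL₂(ℝ) with a·b·c·d ≠ 0. Then the following are equivalent: (a) there exist y₁, y₂ > 0 with g·(i·y₁) = i·y₂ under the Möbius action; (b) |ad| + |bc| = 1; (c) a·b·c·d < 0. Moreover, if a·b·c·d > 0 then there exist unique y₁, y₂ > 0, v > 0, δ₁, δ₂ ∈ {0, 1} and a sign s ∈ {1, −1} such that g = s · A(y₁) · ω^{δ₁} · B(v) · ω^{δ₂} · A(y₂), and these parameters are given explicitly by y₁ = |ab/(cd)|^{1/2}, y₂ = |ac/(bd)|^{1/2}, v = log(|ad|^{1/2} + |bc|^{1/2}). -/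
open Matrix Complex

noncomputable section

/-- `ω = !![0, -1; 1, 0]`. -/
def omegaMat : Matrix (Fin 2) (Fin 2) ℝ := !![0, -1; 1, 0]

/-- `B(v) = !![cosh v, sinh v; sinh v, cosh v]`. -/
def Bmat (v : ℝ) : Matrix (Fin 2) (Fin 2) ℝ :=
  !![Real.cosh v, Real.sinh v; Real.sinh v, Real.cosh v]

/-- The predicate that `t = (y₁, y₂, v, δ₁, δ₂, s)` is a hyperbolic decomposition of `g`:
`y₁, y₂ > 0`, `v > 0`, `δ₁, δ₂ ∈ {0, 1}`, `s ∈ {1, -1}` and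
`g = s • (A(y₁) ω^{δ₁} B(v) ω^{δ₂} A(y₂))`. -/
def HypDecomp (g : Matrix (Fin 2) (Fin 2) ℝ) (t : ℝ × ℝ × ℝ × ℕ × ℕ × ℝ) : Prop :=
  0 < t.1 ∧ 0 < t.2.1 ∧ 0 < t.2.2.1 ∧ t.2.2.2.1 ≤ 1 ∧ t.2.2.2.2.1 ≤ 1 ∧
    (t.2.2.2.2.2 = 1 ∨ t.2.2.2.2.2 = -1) ∧
    g = t.2.2.2.2.2 •
      (Amat t.1 * omegaMat ^ t.2.2.2.1 * Bmat t.2.2.1 * omegaMat ^ t.2.2.2.2.1 * Amat t.2.1)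

lemma hypDecomp_iff (g : Matrix (Fin 2) (Fin 2) ℝ) (y₁ y₂ v s : ℝ) (m n : ℕ) :
    HypDecomp g (y₁, y₂, v, m, n, s) ↔
      0 < y₁ ∧ 0 < y₂ ∧ 0 < v ∧ m ≤ 1 ∧ n ≤ 1 ∧ (s = 1 ∨ s = -1) ∧
        g = s • (Amat y₁ * omegaMat ^ m * Bmat v * omegaMat ^ n * Amat y₂) :=
  Iff.rfl

/-- A positive matrix of determinant one has the form `A(y₁) B(v) A(y₂)`. -/
lemma exists_cosh_sinh_of_pos {a b c d : ℝ} (ha : 0 < a) (hb : 0 < b) (hc : 0 < c) (hd : 0 < d)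
    (hdet : a * d - b * c = 1) :
    ∃ y₁ y₂ v : ℝ, 0 < y₁ ∧ 0 < y₂ ∧ 0 < v ∧
      a = √y₁ * √y₂ * Real.cosh v ∧ b = √y₁ / √y₂ * Real.sinh v ∧
      c = √y₂ / √y₁ * Real.sinh v ∧ d = 1 / (√y₁ * √y₂) * Real.cosh v := by
  obtain ⟨α, hα, rfl⟩ : ∃ x : ℝ, 0 < x ∧ a = x ^ 2 :=
    ⟨√a, Real.sqrt_pos.2 ha, (Real.sq_sqrt ha.le).symm⟩
  obtain ⟨β, hβ, rfl⟩ : ∃ x : ℝ, 0 < x ∧ b = x ^ 2 :=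
    ⟨√b, Real.sqrt_pos.2 hb, (Real.sq_sqrt hb.le).symm⟩
  obtain ⟨γ, hγ, rfl⟩ : ∃ x : ℝ, 0 < x ∧ c = x ^ 2 :=
    ⟨√c, Real.sqrt_pos.2 hc, (Real.sq_sqrt hc.le).symm⟩
  obtain ⟨δ, hδ, rfl⟩ : ∃ x : ℝ, 0 < x ∧ d = x ^ 2 :=
    ⟨√d, Real.sqrt_pos.2 hd, (Real.sq_sqrt hd.le).symm⟩
  have hy₁ : 0 < α * β / (γ * δ) := by positivity
  have hy₂ : 0 < α * γ / (β * δ) := by positivity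
  have hmul : √(α * β / (γ * δ)) * √(α * γ / (β * δ)) = α / δ := by
    rw [← Real.sqrt_mul hy₁.le, ← Real.sqrt_sq (show 0 ≤ α / δ by positivity)]
    congr 1
    field_simp
  have hdiv : √(α * β / (γ * δ)) / √(α * γ / (β * δ)) = β / γ := by
    rw [← Real.sqrt_div hy₁.le, ← Real.sqrt_sq (show 0 ≤ β / γ by positivity)]
    congr 1
    field_simp
  have hdiv' : √(α * γ / (β * δ)) / √(α * β / (γ * δ)) = γ / β := by
    rw [← inv_div, hdiv, inv_div]
  have hcosh : Real.cosh (Real.arsinh (β * γ)) = α * δ := by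
    rw [Real.cosh_arsinh, ← Real.sqrt_sq (show 0 ≤ α * δ by positivity)]
    congr 1
    linarith
  refine ⟨_, _, Real.arsinh (β * γ), hy₁, hy₂, Real.arsinh_pos_iff.2 (by positivity), ?_, ?_, ?_, ?_⟩
  · rw [hmul, hcosh]; field_simp
  · rw [hdiv, Real.sinh_arsinh]; field_simp
  · rw [hdiv', Real.sinh_arsinh]; field_simp
  · rw [hmul, hcosh]; field_simp

/-- The entries of `s A(y₁) ω^m B(v) ω^n A(y₂)`. -/
lemma HypDecomp.entries {g : Matrix (Fin 2) (Fin 2) ℝ} {y₁ y₂ v s : ℝ} {m n : ℕ}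
    (h : HypDecomp g (y₁, y₂, v, m, n, s)) :
    ∃ u w C S : ℝ, 0 < u ∧ 0 < w ∧ y₁ = u ^ 2 ∧ y₂ = w ^ 2 ∧ 0 < C ∧ 0 < S ∧
      Real.exp v = C + S ∧ (s = 1 ∨ s = -1) ∧
      ((m = 0 ∧ n = 0 ∧ g 0 0 = s * (u * w * C) ∧ g 0 1 = s * (u / w * S) ∧
          g 1 0 = s * (w / u * S) ∧ g 1 1 = s * (C / (u * w))) ∨
        (m = 0 ∧ n = 1 ∧ g 0 0 = s * (u * w * S) ∧ g 0 1 = -s * (u / w * C) ∧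
          g 1 0 = s * (w / u * C) ∧ g 1 1 = -s * (S / (u * w))) ∨
        (m = 1 ∧ n = 0 ∧ g 0 0 = -s * (u * w * S) ∧ g 0 1 = -s * (u / w * C) ∧
          g 1 0 = s * (w / u * C) ∧ g 1 1 = s * (S / (u * w))) ∨
        (m = 1 ∧ n = 1 ∧ g 0 0 = -s * (u * w * C) ∧ g 0 1 = s * (u / w * S) ∧
          g 1 0 = s * (w / u * S) ∧ g 1 1 = -s * (C / (u * w)))) := by
  obtain ⟨h₁, h₂, hv, hm, hn, hs, rfl⟩ := (hypDecomp_iff ..).1 h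
  refine ⟨√y₁, √y₂, Real.cosh v, Real.sinh v, Real.sqrt_pos.2 h₁, Real.sqrt_pos.2 h₂,
    (Real.sq_sqrt h₁.le).symm, (Real.sq_sqrt h₂.le).symm, Real.cosh_pos v,
    Real.sinh_pos_iff.2 hv, (Real.cosh_add_sinh v).symm, hs, ?_⟩
  have hu := (Real.sqrt_pos.2 h₁).ne'
  have hw := (Real.sqrt_pos.2 h₂).ne'
  interval_cases m <;> interval_cases n <;>
    simp [Amat, omegaMat, Bmat] <;> field_simp <;> simp

lemma HypDecomp.parameters {g : Matrix (Fin 2) (Fin 2) ℝ} {y₁ y₂ v s : ℝ} {m n : ℕ}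
    (h : HypDecomp g (y₁, y₂, v, m, n, s)) :
    y₁ = √|g 0 0 * g 0 1 / (g 1 0 * g 1 1)| ∧ y₂ = √|g 0 0 * g 1 0 / (g 0 1 * g 1 1)| ∧
      v = Real.log (√|g 0 0 * g 1 1| + √|g 0 1 * g 1 0|) := by
  obtain ⟨u, w, C, S, hu, hw, rfl, rfl, hC, hS, hv, hs, hg⟩ := h.entries
  have key₁ : |g 0 0 * g 0 1 / (g 1 0 * g 1 1)| = (u ^ 2) ^ 2 := by
    rw [← abs_of_pos (show 0 < (u ^ 2) ^ 2 by positivity), abs_eq_abs]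
    rcases hs with rfl | rfl <;>
    rcases hg with ⟨-, -, h1, h2, h3, h4⟩ | ⟨-, -, h1, h2, h3, h4⟩ | ⟨-, -, h1, h2, h3, h4⟩ |
      ⟨-, -, h1, h2, h3, h4⟩ <;> rw [h1, h2, h3, h4] <;> field_simp <;> norm_num
  have key₂ : |g 0 0 * g 1 0 / (g 0 1 * g 1 1)| = (w ^ 2) ^ 2 := by
    rw [← abs_of_pos (show 0 < (w ^ 2) ^ 2 by positivity), abs_eq_abs]
    rcases hs with rfl | rfl <;>
    rcases hg with ⟨-, -, h1, h2, h3, h4⟩ | ⟨-, -, h1, h2, h3, h4⟩ | ⟨-, -, h1, h2, h3, h4⟩ |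
      ⟨-, -, h1, h2, h3, h4⟩ <;> rw [h1, h2, h3, h4] <;> field_simp <;> norm_num
  have key₃ : √|g 0 0 * g 1 1| + √|g 0 1 * g 1 0| = C + S := by
    have e₁ : u * w * C * (C / (u * w)) = C ^ 2 := by field_simp
    have e₂ : u / w * S * (w / u * S) = S ^ 2 := by field_simp
    have e₃ : u * w * S * (S / (u * w)) = S ^ 2 := by field_simp
    have e₄ : u / w * C * (w / u * C) = C ^ 2 := by field_simp
    have hs' : |s| = 1 := by rcases hs with rfl | rfl <;> simp
    rcases hg with ⟨-, -, h1, h2, h3, h4⟩ | ⟨-, -, h1, h2, h3, h4⟩ | ⟨-, -, h1, h2, h3, h4⟩ |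
      ⟨-, -, h1, h2, h3, h4⟩ <;> rw [h1, h2, h3, h4, mul_mul_mul_comm, mul_mul_mul_comm _ (u / w * _)]
    all_goals simp only [e₁, e₂, e₃, e₄, abs_mul, abs_neg, hs', one_mul, abs_pow, sq_abs,
      Real.sqrt_sq hC.le, Real.sqrt_sq hS.le]
    all_goals ring
  rw [key₁, key₂, key₃, ← hv, Real.log_exp, Real.sqrt_sq (by positivity),
    Real.sqrt_sq (by positivity)]
  exact ⟨rfl, rfl, rfl⟩

lemma HypDecomp.signs {g : Matrix (Fin 2) (Fin 2) ℝ} {y₁ y₂ v s : ℝ} {m n : ℕ}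
    (h : HypDecomp g (y₁, y₂, v, m, n, s)) :
    m = (if 0 < g 0 0 * g 1 0 then 0 else 1) ∧ n = (if 0 < g 1 0 * g 1 1 then 0 else 1) ∧
      s = if 0 < g 1 0 then 1 else -1 := by
  obtain ⟨u, w, C, S, hu, hw, -, -, hC, hS, -, hs, hg⟩ := h.entries
  have e₁ : 0 < u * w * C := by positivity
  have e₂ : 0 < u * w * S := by positivity
  have e₃ : 0 < w / u * C := by positivity
  have e₄ : 0 < w / u * S := by positivity
  have e₅ : 0 < C / (u * w) := by positivity
  have e₆ : 0 < S / (u * w) := by positivity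
  rcases hs with rfl | rfl <;>
    rcases hg with ⟨rfl, rfl, h1, -, h3, h4⟩ | ⟨rfl, rfl, h1, -, h3, h4⟩ |
      ⟨rfl, rfl, h1, -, h3, h4⟩ | ⟨rfl, rfl, h1, -, h3, h4⟩ <;>
    rw [h1, h3, h4] <;>
    simp only [neg_neg, neg_mul, one_mul, mul_neg, neg_pos, mul_pos_iff_of_pos_left, not_lt_of_gt, *,
      if_true, if_false, and_self]

lemma exists_hypDecomp {g : Matrix (Fin 2) (Fin 2) ℝ} (hdet : g.det = 1)
    (h : 0 < g 0 0 * g 0 1 * g 1 0 * g 1 1) : ∃ t, HypDecomp g t := by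
  have hne : g 0 0 ≠ 0 ∧ g 0 1 ≠ 0 ∧ g 1 0 ≠ 0 ∧ g 1 1 ≠ 0 := by
    refine ⟨?_, ?_, ?_, ?_⟩ <;> intro h0 <;> simp [h0] at h
  obtain ⟨ha, hb, hc, hd⟩ := hne
  rw [Matrix.det_fin_two] at hdet
  have hprod : 0 < (g 0 0 * g 1 1) * (g 0 1 * g 1 0) := by linarith
  rcases pos_and_pos_or_neg_and_neg_of_mul_pos hprod with ⟨had, hbc⟩ | ⟨had, hbc⟩
  · obtain ⟨y₁, y₂, v, h₁, h₂, hv, ea, eb, ec, ed⟩ := exists_cosh_sinh_of_pos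
      (abs_pos.2 ha) (abs_pos.2 hb) (abs_pos.2 hc) (abs_pos.2 hd)
      (by rwa [← abs_mul, ← abs_mul, abs_of_pos had, abs_of_pos hbc])
    have hu := (Real.sqrt_pos.2 h₁).ne'
    have hw := (Real.sqrt_pos.2 h₂).ne'
    rcases lt_or_gt_of_ne ha with ha | ha <;> rcases lt_or_gt_of_ne hc with hc | hc <;>
      [have hd := neg_of_mul_pos_right had ha.le; have hd := neg_of_mul_pos_right had ha.le;
        have hd := pos_of_mul_pos_right had ha.le; have hd := pos_of_mul_pos_right had ha.le] <;>
      [have hb := neg_of_mul_pos_left hbc hc.le; have hb := pos_of_mul_pos_left hbc hc.le;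
        have hb := neg_of_mul_pos_left hbc hc.le; have hb := pos_of_mul_pos_left hbc hc.le] <;>
      simp only [abs_of_pos, abs_of_neg, ha, hb, hc, hd, neg_eq_iff_eq_neg] at ea eb ec ed <;>
      [use (y₁, y₂, v, 0, 0, -1); use (y₁, y₂, v, 1, 1, 1);
        use (y₁, y₂, v, 1, 1, -1); use (y₁, y₂, v, 0, 0, 1)] <;>
      refine ⟨h₁, h₂, hv, by simp, by simp, by simp, ?_⟩ <;>
      ext i j <;> fin_cases i <;> fin_cases j <;>
      simp [Amat, omegaMat, Bmat, ea, eb, ec, ed] <;> field_simp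
  · obtain ⟨y₁, y₂, v, h₁, h₂, hv, eb, ea, ed, ec⟩ := exists_cosh_sinh_of_pos
      (abs_pos.2 hb) (abs_pos.2 ha) (abs_pos.2 hd) (abs_pos.2 hc)
      (by rw [← abs_mul, ← abs_mul, abs_of_neg had, abs_of_neg hbc]; linarith)
    have hu := (Real.sqrt_pos.2 h₁).ne'
    have hw := (Real.sqrt_pos.2 h₂).ne'
    rcases lt_or_gt_of_ne ha with ha | ha <;> rcases lt_or_gt_of_ne hc with hc | hc <;>
      [have hd := pos_of_mul_neg_right had ha.le; have hd := pos_of_mul_neg_right had ha.le;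
        have hd := neg_of_mul_neg_right had ha.le; have hd := neg_of_mul_neg_right had ha.le] <;>
      [have hb := pos_of_mul_neg_left hbc hc.le; have hb := neg_of_mul_neg_left hbc hc.le;
        have hb := pos_of_mul_neg_left hbc hc.le; have hb := neg_of_mul_neg_left hbc hc.le] <;>
      simp only [abs_of_pos, abs_of_neg, ha, hb, hc, hd, neg_eq_iff_eq_neg] at ea eb ec ed <;>
      [use (y₁, y₂⁻¹, v, 0, 1, -1); use (y₁, y₂⁻¹, v, 1, 0, 1);
        use (y₁, y₂⁻¹, v, 1, 0, -1); use (y₁, y₂⁻¹, v, 0, 1, 1)] <;>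
      refine ⟨h₁, inv_pos.2 h₂, hv, by simp, by simp, by simp, ?_⟩ <;>
      ext i j <;> fin_cases i <;> fin_cases j <;>
      simp [Amat, omegaMat, Bmat, ea, eb, ec, ed] <;> field_simp

lemma abs_add_abs_eq_one_iff_mul_neg {x y : ℝ} (hxy : x - y = 1) (h : x * y ≠ 0) :
    |x| + |y| = 1 ↔ x * y < 0 := by
  have hx : x = y + 1 := by linarith
  subst hx
  constructor
  · intro h1
    by_contra! h2
    rcases pos_and_pos_or_neg_and_neg_of_mul_pos (lt_of_le_of_ne h2 h.symm) with ⟨h3, h4⟩ | ⟨h3, h4⟩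
    · rw [abs_of_pos h3, abs_of_pos h4] at h1; linarith
    · rw [abs_of_neg h3, abs_of_neg h4] at h1; linarith
  · intro h1
    rcases mul_neg_iff.1 h1 with ⟨h3, h4⟩ | ⟨h3, h4⟩
    · rw [abs_of_pos h3, abs_of_neg h4]; ring
    · linarith

lemma exists_moebius_mul_I_iff {a b c d : ℝ} (hdet : a * d - b * c = 1)
    (h : a * b * c * d ≠ 0) :
    (∃ y₁ y₂ : ℝ, 0 < y₁ ∧ 0 < y₂ ∧
        ((a : ℂ) * (Complex.I * (y₁ : ℂ)) + (b : ℂ)) /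
            ((c : ℂ) * (Complex.I * (y₁ : ℂ)) + (d : ℂ)) = Complex.I * (y₂ : ℂ)) ↔
      a * b * c * d < 0 := by
  have hne : ((a ≠ 0 ∧ b ≠ 0) ∧ c ≠ 0) ∧ d ≠ 0 := by simpa only [mul_ne_zero_iff] using h
  obtain ⟨⟨⟨ha, hb⟩, hc⟩, hd⟩ := hne
  have key (y₁ y₂ : ℝ) : ((a : ℂ) * (Complex.I * (y₁ : ℂ)) + (b : ℂ)) /
      ((c : ℂ) * (Complex.I * (y₁ : ℂ)) + (d : ℂ)) = Complex.I * (y₂ : ℂ) ↔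
      b = -(c * y₁ * y₂) ∧ a * y₁ = d * y₂ := by
    have hden : (c : ℂ) * (Complex.I * (y₁ : ℂ)) + (d : ℂ) ≠ 0 := by
      intro h0
      have := congrArg Complex.re h0
      simp at this
      exact hd this
    rw [div_eq_iff hden, Complex.ext_iff]
    simp
    constructor
    · rintro ⟨h1, h2⟩; constructor <;> linarith
    · rintro ⟨h1, h2⟩; constructor <;> linarith
  simp only [key]
  constructor
  · rintro ⟨y₁, y₂, h₁, h₂, hb', had⟩
    have hbc : b * c < 0 := by
      rw [hb', show -(c * y₁ * y₂) * c = -(c ^ 2 * (y₁ * y₂)) by ring]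
      exact neg_neg_of_pos (by positivity)
    have had' : 0 < a * d := by
      refine pos_of_mul_pos_left (b := y₁) ?_ h₁.le
      rw [show a * d * y₁ = d * (a * y₁) by ring, had, show d * (d * y₂) = d ^ 2 * y₂ by ring]
      positivity
    calc a * b * c * d = (a * d) * (b * c) := by ring
      _ < 0 := mul_neg_of_pos_of_neg had' hbc
  · intro hneg
    have hneg' : (a * d) * (b * c) < 0 := by linarith
    have had : 0 < a * d := by
      rcases mul_neg_iff.1 hneg' with ⟨h3, h4⟩ | ⟨h3, h4⟩ <;> linarith
    have hbc : b * c < 0 := by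
      rcases mul_neg_iff.1 hneg' with ⟨h3, h4⟩ | ⟨h3, h4⟩ <;> linarith
    have hq : 0 < -(b * d) / (a * c) := by
      rw [show -(b * d) / (a * c) = (a * d) * -(b * c) / (a * c) ^ 2 by field_simp]
      exact div_pos (mul_pos had (neg_pos.2 hbc)) (by positivity)
    have hr : 0 < a / d := by
      rw [show a / d = a * d / d ^ 2 by field_simp]
      positivity
    refine ⟨√(-(b * d) / (a * c)), a / d * √(-(b * d) / (a * c)), Real.sqrt_pos.2 hq,
      mul_pos hr (Real.sqrt_pos.2 hq), ?_, ?_⟩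
    · rw [show c * √(-(b * d) / (a * c)) * (a / d * √(-(b * d) / (a * c))) =
        c * (a / d) * (√(-(b * d) / (a * c))) ^ 2 by ring, Real.sq_sqrt hq.le]
      field_simp
    · field_simp

theorem stmt10 (g : Matrix (Fin 2) (Fin 2) ℝ) (hdet : g.det = 1)
    (h : g 0 0 * g 0 1 * g 1 0 * g 1 1 ≠ 0) :
    -- (a) ↔ (b)
    ((∃ y₁ y₂ : ℝ, 0 < y₁ ∧ 0 < y₂ ∧
        ((g 0 0 : ℂ) * (Complex.I * (y₁ : ℂ)) + (g 0 1 : ℂ)) /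
            ((g 1 0 : ℂ) * (Complex.I * (y₁ : ℂ)) + (g 1 1 : ℂ)) =
          Complex.I * (y₂ : ℂ)) ↔
      |g 0 0 * g 1 1| + |g 0 1 * g 1 0| = 1) ∧
    -- (b) ↔ (c)
    (|g 0 0 * g 1 1| + |g 0 1 * g 1 0| = 1 ↔ g 0 0 * g 0 1 * g 1 0 * g 1 1 < 0) ∧
    -- decomposition when abcd > 0, with explicit parameters
    (0 < g 0 0 * g 0 1 * g 1 0 * g 1 1 →
      (∃! t : ℝ × ℝ × ℝ × ℕ × ℕ × ℝ, HypDecomp g t) ∧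
      ∀ t : ℝ × ℝ × ℝ × ℕ × ℕ × ℝ, HypDecomp g t →
        t.1 = Real.sqrt |g 0 0 * g 0 1 / (g 1 0 * g 1 1)| ∧
        t.2.1 = Real.sqrt |g 0 0 * g 1 0 / (g 0 1 * g 1 1)| ∧
        t.2.2.1 = Real.log (Real.sqrt |g 0 0 * g 1 1| + Real.sqrt |g 0 1 * g 1 0|)) := by
  have hdet' : g 0 0 * g 1 1 - g 0 1 * g 1 0 = 1 := by rwa [Matrix.det_fin_two] at hdet
  have hprod : g 0 0 * g 0 1 * g 1 0 * g 1 1 = (g 0 0 * g 1 1) * (g 0 1 * g 1 0) := by ring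
  have hbc := abs_add_abs_eq_one_iff_mul_neg hdet' (hprod ▸ h)
  rw [← hprod] at hbc
  refine ⟨(exists_moebius_mul_I_iff hdet' h).trans hbc.symm, hbc, fun hpos => ⟨?_, ?_⟩⟩
  · obtain ⟨t, ht⟩ := exists_hypDecomp hdet hpos
    refine ⟨t, ht, fun t' ht' => ?_⟩
    obtain ⟨y₁, y₂, v, m, n, s⟩ := t
    obtain ⟨y₁', y₂', v', m', n', s'⟩ := t'
    obtain ⟨rfl, rfl, rfl⟩ := ht.parameters
    obtain ⟨rfl, rfl, rfl⟩ := ht.signs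
    obtain ⟨rfl, rfl, rfl⟩ := ht'.parameters
    obtain ⟨rfl, rfl, rfl⟩ := ht'.signs
    rfl
  · rintro ⟨y₁, y₂, v, m, n, s⟩ ht
    exact ht.parameters

end
end

section
/- Let g = !![a, b; c, d] ∈ SL₂(ℝ) with a·b·c·d > 0, and let v = log(|ad|^{1/2} + |bc|^{1/2}) > 0. Then cosh(2v) = |ad + bc|, and 2v = inf{ d_ℍ(g·(i·y), i·y') : y, y' > 0 }, where d_ℍ denotes the hyperbolic distance on the upper half-plane; the infimum is attained, namely d_ℍ(g·(i/y₂), i·y₁) = 2v with y₁ = |ab/(cd)|^{1/2} and y₂ = |ac/(bd)|^{1/2}. -/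
open Matrix UpperHalfPlane

noncomputable section

/-- The point `i·y` of the upper half-plane, for `y > 0`. -/
def iy (y : ℝ) (hy : 0 < y) : UpperHalfPlane := ⟨⟨0, y⟩, hy⟩

/-- The hyperbolic cosine of the distance from the image of one point of the imaginary axis to
another such point. -/
theorem cosh_dist_smul_iy (g : Matrix.SpecialLinearGroup (Fin 2) ℝ) {y y' : ℝ}
    (hy : 0 < y) (hy' : 0 < y') :
    Real.cosh (dist (g • iy y hy) (iy y' hy')) =
      ((g.1 0 0 * y) ^ 2 + g.1 0 1 ^ 2 + (g.1 1 0 * (y * y')) ^ 2 + (g.1 1 1 * y') ^ 2) /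
        (2 * (y * y')) := by
  have hdet : g.1 0 0 * g.1 1 1 - g.1 0 1 * g.1 1 0 = 1 := by
    rw [← Matrix.det_fin_two]; exact g.2
  have hcoe := UpperHalfPlane.coe_specialLinearGroup_apply g (iy y hy)
  have hN : 0 < (g.1 1 0 * y) ^ 2 + g.1 1 1 ^ 2 := by
    rcases eq_or_ne (g.1 1 0) 0 with h0 | h0
    · have : g.1 1 1 ≠ 0 := by
        intro h1
        simp [h0, h1] at hdet
      positivity
    · positivity
  have hre : (g • iy y hy).re =
      (g.1 0 0 * g.1 1 0 * y ^ 2 + g.1 0 1 * g.1 1 1) / ((g.1 1 0 * y) ^ 2 + g.1 1 1 ^ 2) := by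
    rw [← UpperHalfPlane.coe_re, hcoe]
    simp [iy, Complex.div_re, Complex.normSq_apply]
    rw [← add_div]
    congr 1 <;> ring
  have him : (g • iy y hy).im = y / ((g.1 1 0 * y) ^ 2 + g.1 1 1 ^ 2) := by
    rw [← UpperHalfPlane.coe_im, hcoe]
    simp [iy, Complex.div_im, Complex.normSq_apply]
    rw [← sub_div]
    congr 1
    · linear_combination y * hdet
    · ring
  rw [UpperHalfPlane.cosh_dist', hre, him]
  have h1 : (iy y' hy').re = 0 := rfl
  have h2 : (iy y' hy').im = y' := rfl
  rw [h1, h2]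
  generalize g.1 0 0 = a at *
  generalize g.1 0 1 = b at *
  generalize g.1 1 0 = c at *
  generalize g.1 1 1 = d at *
  have hsq : (a * c * y ^ 2 + b * d) ^ 2 + y ^ 2 =
      ((a * y) ^ 2 + b ^ 2) * ((c * y) ^ 2 + d ^ 2) := by
    linear_combination (-y ^ 2 * (a * d - b * c + 1)) * hdet
  clear hre him hcoe
  generalize hM : (c * y) ^ 2 + d ^ 2 = M at *
  have hM' : ((a * c * y ^ 2 + b * d) / M - 0) ^ 2 + (y / M) ^ 2 =
      ((a * y) ^ 2 + b ^ 2) / M := by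
    field_simp
    linear_combination hsq
  rw [hM']
  field_simp
  linear_combination -y' ^ 2 * hM

theorem le_cosh_dist_smul_iy (g : Matrix.SpecialLinearGroup (Fin 2) ℝ) {y y' : ℝ}
    (hy : 0 < y) (hy' : 0 < y') :
    |g.1 0 0 * g.1 1 1| + |g.1 0 1 * g.1 1 0| ≤
      Real.cosh (dist (g • iy y hy) (iy y' hy')) := by
  rw [cosh_dist_smul_iy, le_div_iff₀ (by positivity), abs_mul, abs_mul]
  simp only [mul_pow]
  rw [← sq_abs (g.1 0 0), ← sq_abs (g.1 0 1), ← sq_abs (g.1 1 0), ← sq_abs (g.1 1 1)]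
  nlinarith [sq_nonneg (|g.1 0 0| * y - |g.1 1 1| * y'),
    sq_nonneg (|g.1 1 0| * (y * y') - |g.1 0 1|)]

theorem cosh_dist_smul_iy_of_eq (g : Matrix.SpecialLinearGroup (Fin 2) ℝ) {y y' : ℝ}
    (hy : 0 < y) (hy' : 0 < y') (had : |g.1 0 0| * y = |g.1 1 1| * y')
    (hbc : |g.1 1 0| * (y * y') = |g.1 0 1|) :
    Real.cosh (dist (g • iy y hy) (iy y' hy')) =
      |g.1 0 0 * g.1 1 1| + |g.1 0 1 * g.1 1 0| := by
  rw [cosh_dist_smul_iy, div_eq_iff (by positivity), abs_mul, abs_mul]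
  simp only [mul_pow]
  rw [← sq_abs (g.1 0 0), ← sq_abs (g.1 0 1), ← sq_abs (g.1 1 0), ← sq_abs (g.1 1 1)]
  linear_combination (|g.1 0 0| * y - |g.1 1 1| * y') * had +
    (|g.1 1 0| * (y * y') - |g.1 0 1|) * hbc

theorem one_lt_sqrt_add_sqrt {p q : ℝ} (hp : 0 < p) (hq : 0 < q) (hpq : (p - q) ^ 2 = 1) :
    1 < Real.sqrt p + Real.sqrt q := by
  have hp' := Real.sqrt_pos.2 hp
  have hq' := Real.sqrt_pos.2 hq
  have hsum : 1 ≤ p + q := by nlinarith [mul_pos hp hq]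
  nlinarith [Real.sq_sqrt hp.le, Real.sq_sqrt hq.le, mul_pos hp' hq']

theorem cosh_two_mul_log_sqrt_add_sqrt {p q : ℝ} (hp : 0 < p) (hq : 0 < q)
    (hpq : (p - q) ^ 2 = 1) :
    Real.cosh (2 * Real.log (Real.sqrt p + Real.sqrt q)) = p + q := by
  have hp' := Real.sqrt_pos.2 hp
  have hq' := Real.sqrt_pos.2 hq
  have hlog : 2 * Real.log (Real.sqrt p + Real.sqrt q) =
      Real.log ((Real.sqrt p + Real.sqrt q) ^ 2) := by
    rw [Real.log_pow]; norm_num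
  have hinv : ((Real.sqrt p + Real.sqrt q) ^ 2)⁻¹ = (Real.sqrt p - Real.sqrt q) ^ 2 := by
    refine inv_eq_of_mul_eq_one_right ?_
    rw [← mul_pow, ← sq_sub_sq, Real.sq_sqrt hp.le, Real.sq_sqrt hq.le, hpq]
  rw [hlog, Real.cosh_log (by positivity), hinv]
  linear_combination Real.sq_sqrt hp.le + Real.sq_sqrt hq.le

theorem stmt11 (g : Matrix.SpecialLinearGroup (Fin 2) ℝ)
    (h : 0 < g.1 0 0 * g.1 0 1 * g.1 1 0 * g.1 1 1) :
    0 < Real.log (Real.sqrt |g.1 0 0 * g.1 1 1| + Real.sqrt |g.1 0 1 * g.1 1 0|) ∧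
    Real.cosh (2 * Real.log (Real.sqrt |g.1 0 0 * g.1 1 1| + Real.sqrt |g.1 0 1 * g.1 1 0|)) =
      |g.1 0 0 * g.1 1 1 + g.1 0 1 * g.1 1 0| ∧
    IsLeast
      {r : ℝ | ∃ (y y' : ℝ) (hy : 0 < y) (hy' : 0 < y'),
        r = dist (g • iy y hy) (iy y' hy')}
      (2 * Real.log (Real.sqrt |g.1 0 0 * g.1 1 1| + Real.sqrt |g.1 0 1 * g.1 1 0|)) ∧
    ∀ (h₁ : 0 < Real.sqrt |g.1 0 0 * g.1 0 1 / (g.1 1 0 * g.1 1 1)|)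
      (h₂ : 0 < (Real.sqrt |g.1 0 0 * g.1 1 0 / (g.1 0 1 * g.1 1 1)|)⁻¹),
      dist (g • iy (Real.sqrt |g.1 0 0 * g.1 1 0 / (g.1 0 1 * g.1 1 1)|)⁻¹ h₂)
          (iy (Real.sqrt |g.1 0 0 * g.1 0 1 / (g.1 1 0 * g.1 1 1)|) h₁) =
        2 * Real.log (Real.sqrt |g.1 0 0 * g.1 1 1| + Real.sqrt |g.1 0 1 * g.1 1 0|) := by
  have hdet : g.1 0 0 * g.1 1 1 - g.1 0 1 * g.1 1 0 = 1 := by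
    rw [← Matrix.det_fin_two]; exact g.2
  have hprod : 0 < (g.1 0 0 * g.1 1 1) * (g.1 0 1 * g.1 1 0) := by linarith
  have hp : 0 < |g.1 0 0 * g.1 1 1| := abs_pos.2 (left_ne_zero_of_mul hprod.ne')
  have hq : 0 < |g.1 0 1 * g.1 1 0| := abs_pos.2 (right_ne_zero_of_mul hprod.ne')
  have hpq : (|g.1 0 0 * g.1 1 1| - |g.1 0 1 * g.1 1 0|) ^ 2 = 1 := by
    have habs : |g.1 0 0 * g.1 1 1| * |g.1 0 1 * g.1 1 0| =
        (g.1 0 0 * g.1 1 1) * (g.1 0 1 * g.1 1 0) := by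
      rw [← abs_mul, abs_of_pos hprod]
    linear_combination sq_abs (g.1 0 0 * g.1 1 1) + sq_abs (g.1 0 1 * g.1 1 0) - 2 * habs +
      (g.1 0 0 * g.1 1 1 - g.1 0 1 * g.1 1 0 + 1) * hdet
  have hadd : |g.1 0 0 * g.1 1 1 + g.1 0 1 * g.1 1 0| =
      |g.1 0 0 * g.1 1 1| + |g.1 0 1 * g.1 1 0| :=
    abs_add_eq_add_abs_iff _ _ |>.2 <| by
      rcases pos_and_pos_or_neg_and_neg_of_mul_pos hprod with h' | h'
      · exact Or.inl ⟨h'.1.le, h'.2.le⟩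
      · exact Or.inr ⟨h'.1.le, h'.2.le⟩
  have hpos := Real.log_pos (one_lt_sqrt_add_sqrt hp hq hpq)
  have hcosh := cosh_two_mul_log_sqrt_add_sqrt hp hq hpq
  have ha : 0 < |g.1 0 0| := abs_pos.2 fun h0 => by simp [h0] at h
  have hb : 0 < |g.1 0 1| := abs_pos.2 fun h0 => by simp [h0] at h
  have hc : 0 < |g.1 1 0| := abs_pos.2 fun h0 => by simp [h0] at h
  have hd : 0 < |g.1 1 1| := abs_pos.2 fun h0 => by simp [h0] at h
  have hmin : ∀ (h₁ : 0 < Real.sqrt |g.1 0 0 * g.1 0 1 / (g.1 1 0 * g.1 1 1)|)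
      (h₂ : 0 < (Real.sqrt |g.1 0 0 * g.1 1 0 / (g.1 0 1 * g.1 1 1)|)⁻¹),
      dist (g • iy (Real.sqrt |g.1 0 0 * g.1 1 0 / (g.1 0 1 * g.1 1 1)|)⁻¹ h₂)
          (iy (Real.sqrt |g.1 0 0 * g.1 0 1 / (g.1 1 0 * g.1 1 1)|) h₁) =
        2 * Real.log (Real.sqrt |g.1 0 0 * g.1 1 1| + Real.sqrt |g.1 0 1 * g.1 1 0|) := by
    intro h₁ h₂
    refine Real.cosh_strictMonoOn.injOn (Set.mem_Ici.2 dist_nonneg)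
      (Set.mem_Ici.2 (by positivity)) ?_
    rw [hcosh]
    have hy₁ : Real.sqrt |g.1 0 0 * g.1 0 1 / (g.1 1 0 * g.1 1 1)| ^ 2 =
        |g.1 0 0| * |g.1 0 1| / (|g.1 1 0| * |g.1 1 1|) := by
      rw [Real.sq_sqrt (abs_nonneg _), abs_div, abs_mul, abs_mul]
    have hy₂ : (Real.sqrt |g.1 0 0 * g.1 1 0 / (g.1 0 1 * g.1 1 1)|)⁻¹ ^ 2 =
        (|g.1 0 0| * |g.1 1 0| / (|g.1 0 1| * |g.1 1 1|))⁻¹ := by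
      rw [inv_pow, Real.sq_sqrt (abs_nonneg _), abs_div, abs_mul, abs_mul]
    apply cosh_dist_smul_iy_of_eq
    · rw [← sq_eq_sq₀ (by positivity) (by positivity), mul_pow, mul_pow, hy₁, hy₂]
      field_simp
    · rw [← sq_eq_sq₀ (by positivity) (by positivity), mul_pow, mul_pow, hy₁, hy₂]
      field_simp
  refine ⟨hpos, by rw [hcosh, hadd], ⟨?_, ?_⟩, hmin⟩
  · have h₁ : 0 < Real.sqrt |g.1 0 0 * g.1 0 1 / (g.1 1 0 * g.1 1 1)| := by
      rw [abs_div, abs_mul, abs_mul]; positivity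
    have h₂ : 0 < (Real.sqrt |g.1 0 0 * g.1 1 0 / (g.1 0 1 * g.1 1 1)|)⁻¹ := by
      rw [abs_div, abs_mul, abs_mul]; positivity
    exact ⟨_, _, h₂, h₁, (hmin h₁ h₂).symm⟩
  · rintro _ ⟨y, y', hy, hy', rfl⟩
    have hle := le_cosh_dist_smul_iy g hy hy'
    rw [← hcosh, Real.cosh_le_cosh, abs_of_nonneg (by positivity), abs_of_nonneg dist_nonneg]
      at hle
    exact hle

end
end

section
/- For γ ∈ Γ(2,5) with entries a, b, c, d and associated pair (z₁(γ), z₂(γ)): (i) the map γ ↦ (z₁(γ), z₂(γ)) is injective on Γ(2,5); (ii) N(z₁(γ)) = 5·N(z₂(γ)) + 1; (iii) for all integers j₁, j₂, the matrix h₀^{j₁} γ h₀^{j₂} lies in Γ(2,5) and its associated pair is (ε^{2(j₁+j₂)}·z₁(γ), ε^{2(j₁−j₂)}·z₂(γ)); (iv) a·b·c·d = 0 if and only if z₂(γ) = 0, if and only if γ = ± h₀^m for some m ∈ ℤ; (v) if all four entries of γ are nonzero, then the parameters y₁ = |ab/(cd)|^{1/2} and y₂ = |ac/(bd)|^{1/2}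 satisfy y₁ = |z₁(γ)·z₂(γ)/(σ(z₁(γ))·σ(z₂(γ)))|^{1/2} and y₂ = |z₁(γ)·σ(z₂(γ))/(σ(z₁(γ))·z₂(γ))|^{1/2}. -/
open Matrix

noncomputable section

/-- `ℤ[√2]`, the ring of integers of `ℚ(√2)`. -/
abbrev Zrt2 := Zsqrtd 2

/-- The real embedding `u + v√2 ↦ u + v·√2`. -/
def toR (z : Zrt2) : ℝ := z.re + z.im * Real.sqrt 2

/-- The Galois conjugation `σ(u + v√2) = u − v√2`. -/
def sigma (z : Zrt2) : Zrt2 := ⟨z.re, -z.im⟩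

/-- The fundamental unit `ε = 1 + √2` as a unit of `ℤ[√2]`. -/
def epsUnit : (Zrt2)ˣ := ⟨⟨1, 1⟩, ⟨-1, 1⟩, by decide, by decide⟩

/-- The matrix of `Γ(2,5)` attached to the pair `(z₁, z₂) ∈ ℤ[√2]²`, namely
`!![z₁, √5·z₂; √5·σ(z₂), σ(z₁)]`. -/
def mat25 (z₁ z₂ : Zrt2) : Matrix (Fin 2) (Fin 2) ℝ :=
  !![toR z₁, Real.sqrt 5 * toR z₂; Real.sqrt 5 * toR (sigma z₂), toR (sigma z₁)]

/-- `h₀ = !![ε², 0; 0, ε⁻²]`. -/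
def h0 : Matrix (Fin 2) (Fin 2) ℝ :=
  !![(1 + Real.sqrt 2) ^ 2, 0; 0, ((1 + Real.sqrt 2) ^ 2)⁻¹]

theorem toR_mul (z w : Zrt2) : toR (z * w) = toR z * toR w := by
  have h : Real.sqrt 2 * Real.sqrt 2 = 2 := Real.mul_self_sqrt (by norm_num)
  simp only [toR, Zsqrtd.re_mul, Zsqrtd.im_mul]
  push_cast
  linear_combination (-(z.im : ℝ) * w.im) * h

theorem sigma_eq_star (z : Zrt2) : sigma z = star z := rfl

theorem toR_mul_toR_sigma (z : Zrt2) : toR z * toR (sigma z) = (z.norm : ℝ) := by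
  have h : Real.sqrt 2 * Real.sqrt 2 = 2 := Real.mul_self_sqrt (by norm_num)
  simp only [toR, sigma, Zsqrtd.norm]
  push_cast
  linear_combination (-(z.im : ℝ) * z.im) * h

theorem toR_neg (z : Zrt2) : toR (-z) = -toR z := by
  simp only [toR, Zsqrtd.re_neg, Zsqrtd.im_neg]
  push_cast
  ring

theorem toR_zero : toR 0 = 0 := by simp [toR]

theorem eq_of_toR_eq {z w : Zrt2} (h : toR z = toR w) (h' : toR (sigma z) = toR (sigma w)) :
    z = w := by
  have h2 : (0 : ℝ) < Real.sqrt 2 := by positivity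
  simp only [toR, sigma] at h h'
  push_cast at h h'
  have hre : (z.re : ℝ) = w.re := by linarith
  have him : (z.im : ℝ) = w.im := by
    apply mul_right_cancel₀ h2.ne'
    linarith
  exact Zsqrtd.ext (by exact_mod_cast hre) (by exact_mod_cast him)

theorem eq_zero_of_norm_eq_zero {z : Zrt2} (h : z.norm = 0) : z = 0 := by
  refine (Zsqrtd.norm_eq_zero (fun n hn => ?_) z).1 h
  have h1 : n < 2 := by nlinarith
  have h2 : -2 < n := by nlinarith
  interval_cases n <;> omega

theorem mat25_injective {z₁ z₂ w₁ w₂ : Zrt2} (h : mat25 z₁ z₂ = mat25 w₁ w₂) :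
    z₁ = w₁ ∧ z₂ = w₂ := by
  have h5 : Real.sqrt 5 ≠ 0 := by positivity
  have e00 := congrFun (congrFun h 0) 0
  have e01 := congrFun (congrFun h 0) 1
  have e10 := congrFun (congrFun h 1) 0
  have e11 := congrFun (congrFun h 1) 1
  simp only [mat25, Matrix.of_apply, Matrix.cons_val', Matrix.cons_val_zero, Matrix.cons_val_one,
    Matrix.cons_val_fin_one] at e00 e01 e10 e11
  exact ⟨eq_of_toR_eq e00 e11, eq_of_toR_eq (mul_left_cancel₀ h5 e01) (mul_left_cancel₀ h5 e10)⟩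

theorem det_mat25 (z₁ z₂ : Zrt2) : (mat25 z₁ z₂).det = ((z₁.norm - 5 * z₂.norm : ℤ) : ℝ) := by
  have h5 : Real.sqrt 5 * Real.sqrt 5 = 5 := Real.mul_self_sqrt (by norm_num)
  rw [mat25, Matrix.det_fin_two_of]
  push_cast
  rw [← toR_mul_toR_sigma, ← toR_mul_toR_sigma]
  linear_combination (-toR z₂ * toR (sigma z₂)) * h5

theorem mat25_zero_mul (u z₁ z₂ : Zrt2) : mat25 u 0 * mat25 z₁ z₂ = mat25 (u * z₁) (u * z₂) := by
  ext i j
  fin_cases i <;> fin_cases j <;>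
    simp [mat25, sigma_eq_star, toR_mul, toR_zero, Matrix.mul_apply] <;> ring

theorem mat25_mul_zero (z₁ z₂ u : Zrt2) :
    mat25 z₁ z₂ * mat25 u 0 = mat25 (u * z₁) (sigma u * z₂) := by
  ext i j
  fin_cases i <;> fin_cases j <;>
    simp [mat25, sigma_eq_star, toR_mul, toR_zero, Matrix.mul_apply] <;> ring

theorem neg_mat25_zero (z : Zrt2) : -mat25 z 0 = mat25 (-z) 0 := by
  ext i j
  fin_cases i <;> fin_cases j <;> simp [mat25, sigma_eq_star, toR_neg, toR_zero]

/-- The multiplicative embedding of `ℤ[√2]` as diagonal matrices `diag(z, σ(z))`. -/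
def diagHom : Zrt2 →* Matrix (Fin 2) (Fin 2) ℝ where
  toFun z := mat25 z 0
  map_one' := by
    ext i j
    fin_cases i <;> fin_cases j <;> simp [mat25, sigma_eq_star, toR]
  map_mul' z w := by rw [mat25_zero_mul, mul_zero]

theorem star_epsUnit_sq : star (epsUnit ^ (2 : ℤ)) = (epsUnit ^ (2 : ℤ))⁻¹ := by
  apply Units.ext
  decide

theorem sigma_epsUnit_zpow (j : ℤ) :
    sigma ((epsUnit ^ (2 * j) : (Zrt2)ˣ) : Zrt2) = ((epsUnit ^ (2 * -j) : (Zrt2)ˣ) : Zrt2) := by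
  rw [sigma_eq_star, ← Units.coe_star, _root_.zpow_mul, star_zpow, star_epsUnit_sq, _root_.inv_zpow, _root_.zpow_mul,
    _root_.zpow_neg]

theorem norm_epsUnit_zpow (j : ℤ) : ((epsUnit ^ (2 * j) : (Zrt2)ˣ) : Zrt2).norm = 1 := by
  have h := Zsqrtd.norm_eq_mul_conj ((epsUnit ^ (2 * j) : (Zrt2)ˣ) : Zrt2)
  rw [← sigma_eq_star, sigma_epsUnit_zpow, ← Units.val_mul, ← _root_.zpow_add] at h
  have e : 2 * j + 2 * -j = 0 := by ring
  rw [e, _root_.zpow_zero, Units.val_one] at h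
  exact_mod_cast h

theorem h0_eq : h0 = mat25 ((epsUnit ^ (2 : ℤ) : (Zrt2)ˣ) : Zrt2) 0 := by
  have h : Real.sqrt 2 * Real.sqrt 2 = 2 := Real.mul_self_sqrt (by norm_num)
  have hu : ((epsUnit ^ (2 : ℤ) : (Zrt2)ˣ) : Zrt2) = ⟨3, 2⟩ := by decide
  have hinv : ((1 + Real.sqrt 2) ^ 2)⁻¹ = 3 - 2 * Real.sqrt 2 := by
    apply inv_eq_of_mul_eq_one_right
    linear_combination (-1 - 2 * Real.sqrt 2) * h
  rw [hu, h0, hinv]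
  ext i j
  fin_cases i <;> fin_cases j <;> simp [mat25, sigma, toR]
  · linear_combination h
  · ring

theorem h0_zpow (j : ℤ) : h0 ^ j = mat25 ((epsUnit ^ (2 * j) : (Zrt2)ˣ) : Zrt2) 0 := by
  have h : h0 = ((Units.map diagHom (epsUnit ^ (2 : ℤ)) : (Matrix (Fin 2) (Fin 2) ℝ)ˣ) :
      Matrix (Fin 2) (Fin 2) ℝ) := h0_eq
  rw [h, ← Matrix.coe_units_zpow, ← map_zpow, ← _root_.zpow_mul]
  rfl

/-- The fundamental solution `(3, 2)` of the Pell equation `x² − 2y² = 1`. -/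
def pellThreeTwo : Pell.Solution₁ 2 := Pell.Solution₁.mk 3 2 (by norm_num)

theorem isFundamental_pellThreeTwo : Pell.IsFundamental pellThreeTwo := by
  refine ⟨by simp [pellThreeTwo], by simp [pellThreeTwo], fun {b} hb => ?_⟩
  have hp := b.prop
  simp only [pellThreeTwo, Pell.Solution₁.x_mk]
  by_contra! hlt
  have h2 : b.x = 2 := by omega
  rw [h2] at hp
  omega

theorem coe_pellThreeTwo_zpow (m : ℤ) :
    ((pellThreeTwo ^ m : Pell.Solution₁ 2) : Zrt2) =
      ((epsUnit ^ (2 * m) : (Zrt2)ˣ) : Zrt2) := by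
  have h : Unitary.toUnits pellThreeTwo = epsUnit ^ (2 : ℤ) := by
    apply Units.ext
    decide
  rw [_root_.zpow_mul, ← h]
  exact congrArg Units.val (map_zpow (Unitary.toUnits (R := Zrt2)) pellThreeTwo m)

theorem eq_or_eq_neg_epsUnit_zpow {z : Zrt2} (hz : z.norm = 1) :
    ∃ m : ℤ, z = ((epsUnit ^ (2 * m) : (Zrt2)ˣ) : Zrt2) ∨
      z = -((epsUnit ^ (2 * m) : (Zrt2)ˣ) : Zrt2) := by
  let s : Pell.Solution₁ 2 :=
    Pell.Solution₁.mk z.re z.im (by rw [Zsqrtd.norm] at hz; linarith)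
  have hs : (s : Zrt2) = z := rfl
  obtain ⟨m, hm | hm⟩ := isFundamental_pellThreeTwo.eq_zpow_or_neg_zpow s
  · exact ⟨m, Or.inl (by rw [← hs, hm, coe_pellThreeTwo_zpow])⟩
  · exact ⟨m, Or.inr (by rw [← hs, hm, ← coe_pellThreeTwo_zpow]; rfl)⟩

theorem eq_zero_of_toR {z : Zrt2} (h : toR z = 0 ∨ toR (sigma z) = 0) : z = 0 := by
  apply eq_zero_of_norm_eq_zero
  have := toR_mul_toR_sigma z
  rw [mul_eq_zero.2 h] at this
  exact_mod_cast this.symm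

theorem stmt13 :
    -- (i) injectivity of γ ↦ (z₁(γ), z₂(γ)), i.e. distinct pairs give distinct
    -- elements of Γ(2,5)
    (Set.InjOn (fun p : Zrt2 × Zrt2 => mat25 p.1 p.2)
      {p : Zrt2 × Zrt2 | p.1.norm = 5 * p.2.norm + 1}) ∧
    -- (ii) the determinant-1 condition is exactly N(z₁) = 5·N(z₂) + 1
    (∀ z₁ z₂ : Zrt2, (mat25 z₁ z₂).det = 1 ↔ z₁.norm = 5 * z₂.norm + 1) ∧
    -- (iii) behaviour under h₀^{j₁} γ h₀^{j₂}
    (∀ z₁ z₂ : Zrt2, z₁.norm = 5 * z₂.norm + 1 → ∀ j₁ j₂ : ℤ,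
      h0 ^ j₁ * mat25 z₁ z₂ * h0 ^ j₂ =
        mat25 (((epsUnit ^ (2 * (j₁ + j₂)) : (Zrt2)ˣ) : Zrt2) * z₁)
          (((epsUnit ^ (2 * (j₁ - j₂)) : (Zrt2)ˣ) : Zrt2) * z₂) ∧
      (((epsUnit ^ (2 * (j₁ + j₂)) : (Zrt2)ˣ) : Zrt2) * z₁).norm =
        5 * (((epsUnit ^ (2 * (j₁ - j₂)) : (Zrt2)ˣ) : Zrt2) * z₂).norm + 1) ∧
    -- (iv) abcd = 0 ↔ z₂ = 0 ↔ γ = ± h₀^m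
    (∀ z₁ z₂ : Zrt2, z₁.norm = 5 * z₂.norm + 1 →
      ((mat25 z₁ z₂ 0 0 * mat25 z₁ z₂ 0 1 * mat25 z₁ z₂ 1 0 * mat25 z₁ z₂ 1 1 = 0 ↔
          z₂ = 0) ∧
       (z₂ = 0 ↔ ∃ m : ℤ, mat25 z₁ z₂ = h0 ^ m ∨ mat25 z₁ z₂ = -(h0 ^ m)))) ∧
    -- (v) the formulas for y₁ and y₂
    (∀ z₁ z₂ : Zrt2, z₁.norm = 5 * z₂.norm + 1 →
      mat25 z₁ z₂ 0 0 ≠ 0 → mat25 z₁ z₂ 0 1 ≠ 0 → mat25 z₁ z₂ 1 0 ≠ 0 →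
      mat25 z₁ z₂ 1 1 ≠ 0 →
      Real.sqrt |mat25 z₁ z₂ 0 0 * mat25 z₁ z₂ 0 1 / (mat25 z₁ z₂ 1 0 * mat25 z₁ z₂ 1 1)| =
        Real.sqrt |toR z₁ * toR z₂ / (toR (sigma z₁) * toR (sigma z₂))| ∧
      Real.sqrt |mat25 z₁ z₂ 0 0 * mat25 z₁ z₂ 1 0 / (mat25 z₁ z₂ 0 1 * mat25 z₁ z₂ 1 1)| =
        Real.sqrt |toR z₁ * toR (sigma z₂) / (toR (sigma z₁) * toR z₂)|) := by
  refine ⟨?_, ?_, ?_, ?_, ?_⟩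
  · rintro ⟨z₁, z₂⟩ - ⟨w₁, w₂⟩ - h
    obtain ⟨rfl, rfl⟩ := mat25_injective h
    rfl
  · intro z₁ z₂
    rw [det_mat25, Int.cast_eq_one]
    omega
  · intro z₁ z₂ h j₁ j₂
    constructor
    · rw [h0_zpow, h0_zpow, mat25_zero_mul, mat25_mul_zero, sigma_epsUnit_zpow, ← mul_assoc,
        ← mul_assoc, ← Units.val_mul, ← Units.val_mul, ← _root_.zpow_add, ← _root_.zpow_add]
      congr 4 <;> ring_nf
    · rw [Zsqrtd.norm_mul, Zsqrtd.norm_mul, norm_epsUnit_zpow, norm_epsUnit_zpow, one_mul, one_mul,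
        h]
  · intro z₁ z₂ h
    refine ⟨⟨fun h0 => ?_, fun h0 => ?_⟩, fun h0 => ?_, ?_⟩
    · have h5 : Real.sqrt 5 ≠ 0 := by positivity
      have hz₁ : z₁ ≠ 0 := by
        rintro rfl
        rw [Zsqrtd.norm_zero] at h
        omega
      simp only [mat25, Matrix.of_apply, Matrix.cons_val', Matrix.cons_val_zero,
        Matrix.cons_val_one, Matrix.cons_val_fin_one, mul_eq_zero, h5, false_or] at h0
      rcases h0 with ((h0 | h0) | h0) | h0
      · exact absurd (eq_zero_of_toR (Or.inl h0)) hz₁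
      · exact eq_zero_of_toR (Or.inl h0)
      · exact eq_zero_of_toR (Or.inr h0)
      · exact absurd (eq_zero_of_toR (Or.inr h0)) hz₁
    · simp [h0, mat25, toR_zero]
    · subst h0
      rw [Zsqrtd.norm_zero, mul_zero, zero_add] at h
      obtain ⟨m, hm⟩ := eq_or_eq_neg_epsUnit_zpow h
      refine ⟨m, hm.imp (fun hm => ?_) (fun hm => ?_)⟩
      · rw [h0_zpow, hm]
      · rw [h0_zpow, neg_mat25_zero, hm]
    · rintro ⟨m, hm | hm⟩
      · rw [h0_zpow] at hm
        exact (mat25_injective hm).2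
      · rw [h0_zpow, neg_mat25_zero] at hm
        exact (mat25_injective hm).2
  · intro z₁ z₂ _ _ _ _ _
    have h5 : Real.sqrt 5 ≠ 0 := by positivity
    simp only [mat25, Matrix.of_apply, Matrix.cons_val', Matrix.cons_val_zero,
      Matrix.cons_val_one, Matrix.cons_val_fin_one]
    constructor
    · rw [mul_left_comm, mul_assoc (Real.sqrt 5), mul_div_mul_left _ _ h5,
        mul_comm (toR (sigma z₂))]
    · rw [mul_left_comm, mul_assoc (Real.sqrt 5), mul_div_mul_left _ _ h5, mul_comm (toR z₂)]

end
end
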